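/- The boundary conditions imposed on ∂D₊∩{x∈ℝ²: x₂=0} in the transformed system (z4) (namely u_σ=(ε₂+iσ/ω)w_σ and ε₁⁻¹J₊(Ψ*₊∇u_σ)ᵀ·n=−J₋(Ψ̂*₊∇w_σ)ᵀ·n) are complementing boundary conditions in the sense of Agmon–Douglis–Nirenberg: for every boundary point x₀∈∂D₊∩{x₂=0} and every nonzero real tangent vector ξ, the rows of the polynomial matrix (B'ᵢⱼ(x₀;ξ+τn))(L*ⱼₖ(x₀;ξ+τn)) are linearly independent modulo M⁺(x₀;ξ,τ). -/

import Mathlib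

open MeasureTheory Topology Filter

noncomputable section

namespace Helmholtz

/-- A point of the plane `ℝ²`. -/
abbrev Pt := ℝ × ℝ

/-- The geometric and material data of the periodic transmission problem:
a `Λ`-periodic, non-constant `C²` grating profile `f` with `0 < f < h₁`,
a conventional material (`ε₁, μ₁ > 0`) above the grating and a negative index
material (`ε₂, μ₂ < 0`) below it, incidence angle `θ ∈ (-π/2, π/2)`. -/
structure Ctx : Type where
  Λ : ℝ
  h₁ : ℝ
  f : ℝ → ℝ
  ε₁ : ℝ
  μ₁ : ℝ
  ε₂ : ℝ
  μ₂ : ℝ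
  θ : ℝ
  hΛ : 0 < Λ
  hf : ContDiff ℝ 2 f
  hper : ∀ x, f (x + Λ) = f x
  hnonconst : ∃ x y, f x ≠ f y
  hfpos : ∀ x, 0 < f x
  hfh : ∀ x, f x < h₁
  hε₁ : 0 < ε₁
  hμ₁ : 0 < μ₁
  hε₂ : ε₂ < 0
  hμ₂ : μ₂ < 0
  hratio : ε₁ / ε₂ ≠ -1
  hθl : -(Real.pi / 2) < θ
  hθr : θ < Real.pi / 2

/-- Wave number `κ₁ = ω √(ε₁ μ₁)` of the medium above the grating. -/
def κ₁ (C : Ctx) (ω : ℝ) : ℝ := ω * Real.sqrt (C.ε₁ * C.μ₁)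

/-- `α = κ₁ sin θ`. -/
def αp (C : Ctx) (ω : ℝ) : ℝ := κ₁ C ω * Real.sin C.θ

/-- `β = κ₁ cos θ`. -/
def βp (C : Ctx) (ω : ℝ) : ℝ := κ₁ C ω * Real.cos C.θ

/-- `αₙ = α + 2πn/Λ`. -/
def αn (C : Ctx) (ω : ℝ) (n : ℤ) : ℝ := αp C ω + 2 * Real.pi * (n : ℝ) / C.Λ

/-- The propagation constants `βₙ`. -/
def βn (C : Ctx) (ω : ℝ) (n : ℤ) : ℂ :=
  if |αn C ω n| < κ₁ C ω then ((Real.sqrt (κ₁ C ω ^ 2 - αn C ω n ^ 2) : ℝ) : ℂ)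
  else Complex.I * ((Real.sqrt (αn C ω n ^ 2 - κ₁ C ω ^ 2) : ℝ) : ℂ)

/-- The region `Ω₁` between the grating and the artificial boundary `Γ₀`. -/
def Ω₁set (C : Ctx) : Set Pt := {p | 0 < p.1 ∧ p.1 < C.Λ ∧ C.f p.1 < p.2 ∧ p.2 < C.h₁}

/-- The region `Ω₂` between the grating and the perfectly conducting boundary `Γ`. -/
def Ω₂set (C : Ctx) : Set Pt := {p | 0 < p.1 ∧ p.1 < C.Λ ∧ 0 < p.2 ∧ p.2 < C.f p.1}

/-- The grating profile `S`. -/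
def Sset (C : Ctx) : Set Pt := {p | 0 < p.1 ∧ p.1 < C.Λ ∧ p.2 = C.f p.1}

/-- The full (bounded) domain `Ω = Ω₁ ∪ Ω₂ ∪ S`. -/
def Ωset (C : Ctx) : Set Pt := Ω₁set C ∪ Ω₂set C ∪ Sset C

/-- Pointwise squared length of the gradient of a complex valued function. -/
def gradSq (u : Pt → ℂ) (p : Pt) : ℝ :=
  ‖fderiv ℝ u p (1, 0)‖ ^ 2 + ‖fderiv ℝ u p (0, 1)‖ ^ 2

/-- `∫_A |u|²`. -/
def L2sqOn (A : Set Pt) (u : Pt → ℂ) : ℝ := ∫ p in A, ‖u p‖ ^ 2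

/-- The `L²(A)` norm. -/
def L2normOn (A : Set Pt) (u : Pt → ℂ) : ℝ := Real.sqrt (L2sqOn A u)

/-- `∫_A |∇u|²`. -/
def gradL2On (A : Set Pt) (u : Pt → ℂ) : ℝ := ∫ p in A, gradSq u p

/-- The `H¹(A)` norm. -/
def H1normOn (A : Set Pt) (u : Pt → ℂ) : ℝ := Real.sqrt (L2sqOn A u + gradL2On A u)

/-- Pointwise squared length of the Hessian of a complex valued function. -/
def hessSq (u : Pt → ℂ) (p : Pt) : ℝ :=
  ‖fderiv ℝ (fun q => fderiv ℝ u q (1, 0)) p (1, 0)‖ ^ 2 +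
  ‖fderiv ℝ (fun q => fderiv ℝ u q (1, 0)) p (0, 1)‖ ^ 2 +
  ‖fderiv ℝ (fun q => fderiv ℝ u q (0, 1)) p (1, 0)‖ ^ 2 +
  ‖fderiv ℝ (fun q => fderiv ℝ u q (0, 1)) p (0, 1)‖ ^ 2

/-- The `H²(A)` norm. -/
def H2normOn (A : Set Pt) (u : Pt → ℂ) : ℝ :=
  Real.sqrt (L2sqOn A u + gradL2On A u + ∫ p in A, hessSq u p)

/-- Membership in `H¹(A)` (square integrability of `u` and of its gradient). -/
def MemH1On (A : Set Pt) (u : Pt → ℂ) : Prop :=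
  IntegrableOn (fun p => ‖u p‖ ^ 2) A volume ∧ IntegrableOn (gradSq u) A volume

/-- Membership in `H²(A)`. -/
def MemH2On (A : Set Pt) (u : Pt → ℂ) : Prop :=
  MemH1On A u ∧ IntegrableOn (hessSq u) A volume

/-- Membership in the quasi-periodic space `H¹_{qp}(A)`:
`u ∈ H¹(A)` together with `u(0,x₂) = u(Λ,x₂) e^{-iαΛ}`. -/
def MemH1qp (C : Ctx) (ω : ℝ) (A : Set Pt) (u : Pt → ℂ) : Prop :=
  MemH1On A u ∧
    ∀ x₂ : ℝ, u (0, x₂) = u (C.Λ, x₂) * Complex.exp (-(Complex.I * (αp C ω : ℂ) * (C.Λ : ℂ)))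

/-- `n`-th Fourier coefficient of a quasi-periodic function of one variable. -/
def fc (C : Ctx) (ω : ℝ) (w : ℝ → ℂ) (n : ℤ) : ℂ :=
  ((1 / C.Λ : ℝ) : ℂ) * ∫ x in (0 : ℝ)..C.Λ, w x * Complex.exp (-(Complex.I * (αn C ω n : ℂ) * (x : ℂ)))

/-- The quasi-periodic trace norm `‖w‖_{H^s} = (Λ ∑ₙ (1+αₙ²)^s |wₙ|²)^{1/2}`. -/
def HsNorm (C : Ctx) (ω s : ℝ) (w : ℝ → ℂ) : ℝ :=
  Real.sqrt (C.Λ * ∑' n : ℤ, (1 + αn C ω n ^ 2) ^ s * ‖fc C ω w n‖ ^ 2)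

/-- Membership in the trace space `H^s_{qp}` (finiteness of the `H^s` norm). -/
def MemHs (C : Ctx) (ω s : ℝ) (w : ℝ → ℂ) : Prop :=
  Summable (fun n : ℤ => (1 + αn C ω n ^ 2) ^ s * ‖fc C ω w n‖ ^ 2)

/-- Dirichlet-to-Neumann map `(Tw)(x₁) = ∑ₙ i βₙ wₙ e^{i αₙ x₁}`. -/
def DtN (C : Ctx) (ω : ℝ) (w : ℝ → ℂ) (x : ℝ) : ℂ :=
  ∑' n : ℤ, Complex.I * βn C ω n * fc C ω w n * Complex.exp (Complex.I * (αn C ω n : ℂ) * (x : ℂ))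

/-- Boundary datum `g(x₁) = -2iβ e^{i(αx₁ - βh₁)}` of the scattering problem. -/
def gdef (C : Ctx) (ω : ℝ) (x : ℝ) : ℂ :=
  -2 * Complex.I * (βp C ω : ℂ) * Complex.exp (Complex.I * ((αp C ω * x - βp C ω * C.h₁ : ℝ) : ℂ))

/-- Trace of `u` on the grating `S`. -/
def traceS (C : Ctx) (u : Pt → ℂ) : ℝ → ℂ := fun x => u (x, C.f x)

/-- Trace of `u` on the artificial boundary `Γ₀`. -/
def traceΓ₀ (C : Ctx) (u : Pt → ℂ) : ℝ → ℂ := fun x => u (x, C.h₁)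

/-- (Non-normalized) normal vector `(-f'(x), 1)` of the grating `S`. -/
def nuVec (C : Ctx) (x : ℝ) : Pt := (-(deriv C.f x), 1)

/-- Normal derivative `∂_ν u` on the grating `S`. -/
def nuDerivS (C : Ctx) (u : Pt → ℂ) (x : ℝ) : ℂ :=
  fderiv ℝ u (x, C.f x) (nuVec C x) / ((Real.sqrt (1 + deriv C.f x ^ 2) : ℝ) : ℂ)

/-- One-sided normal derivative of `u` on `S` (one-sided limit of `∂_ν u` along the normal,
`side = 𝓝[>] 0` from `Ω₁`, `side = 𝓝[<] 0` from `Ω₂`). -/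
def nuLim (C : Ctx) (u : Pt → ℂ) (x : ℝ) (side : Filter ℝ) : ℂ :=
  limUnder side (fun t => fderiv ℝ u ((x, C.f x) + t • nuVec C x) (nuVec C x)) /
    ((Real.sqrt (1 + deriv C.f x ^ 2) : ℝ) : ℂ)

/-- Pointwise Laplacian of a complex valued function. -/
def lap (u : Pt → ℂ) (p : Pt) : ℂ :=
  fderiv ℝ (fun q => fderiv ℝ u q (1, 0)) p (1, 0) +
  fderiv ℝ (fun q => fderiv ℝ u q (0, 1)) p (0, 1)

/-- The absorbing permittivity `ε_σ = ε₂ + iσ/ω` of the negative index region. -/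
def εσc (C : Ctx) (ω σ : ℝ) : ℂ := (C.ε₂ : ℂ) + Complex.I * (σ : ℂ) / (ω : ℂ)

/-- `u` solves the boundary value problem (Pσ) with boundary datum `g` on `Γ₀`:
the Helmholtz equations with (absorbing, sign-changing) coefficients in `Ω₁` and `Ω₂`,
the transmission conditions on `S`, the DtN condition `∂₂u = Tu + g` on `Γ₀` and the
Neumann condition `∂₂u = 0` on `Γ`.  The case `σ = 0` is the problem (P₀). -/
def IsSolution (C : Ctx) (ω σ : ℝ) (g : ℝ → ℂ) (u : Pt → ℂ) : Prop :=
  MemH1qp C ω (Ωset C) u ∧ ContinuousOn u (Ωset C) ∧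
  (∀ p ∈ Ω₁set C, ((C.ε₁ : ℝ) : ℂ)⁻¹ * lap u p + ((ω ^ 2 * C.μ₁ : ℝ) : ℂ) * u p = 0) ∧
  (∀ p ∈ Ω₂set C,
      (εσc C ω σ)⁻¹ * lap u p + ((ω ^ 2 * C.μ₂ : ℝ) : ℂ) * u p + Complex.I * (σ : ℂ) * u p = 0) ∧
  (∀ x ∈ Set.Ioo (0 : ℝ) C.Λ,
      ((C.ε₁ : ℝ) : ℂ)⁻¹ * nuLim C u x (𝓝[>] (0 : ℝ)) =
      (εσc C ω σ)⁻¹ * nuLim C u x (𝓝[<] (0 : ℝ))) ∧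
  (∀ x ∈ Set.Ioo (0 : ℝ) C.Λ,
      fderiv ℝ u (x, C.h₁) ((0 : ℝ), (1 : ℝ)) = DtN C ω (traceΓ₀ C u) x + g x) ∧
  (∀ x ∈ Set.Ioo (0 : ℝ) C.Λ, fderiv ℝ u (x, (0 : ℝ)) ((0 : ℝ), (1 : ℝ)) = 0)

/-- `u` is the unique solution of (Pσ) (uniqueness as functions on `Ω`). -/
def UniqueSolution (C : Ctx) (ω σ : ℝ) (g : ℝ → ℂ) (u : Pt → ℂ) : Prop :=
  IsSolution C ω σ g u ∧ ∀ v, IsSolution C ω σ g v → Set.EqOn v u (Ωset C)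

/-- `⟨∇u, ∇v⟩_{L²(A)}`. -/
def gradInner (A : Set Pt) (u v : Pt → ℂ) : ℂ :=
  ∫ p in A,
    (fderiv ℝ u p (1, 0) * (starRingEnd ℂ) (fderiv ℝ v p (1, 0)) +
     fderiv ℝ u p (0, 1) * (starRingEnd ℂ) (fderiv ℝ v p (0, 1)))

/-- The `H¹(A)` inner product. -/
def H1innerOn (A : Set Pt) (u v : Pt → ℂ) : ℂ :=
  (∫ p in A, u p * (starRingEnd ℂ) (v p)) + gradInner A u v

/-- The sesquilinear form `b(u,v) = ⟨ε_σ⁻¹∇u, ∇v⟩_Ω - ⟨ε₁⁻¹ T u, v⟩_{Γ₀}`. -/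
def bForm (C : Ctx) (ω σ : ℝ) (u v : Pt → ℂ) : ℂ :=
  ((C.ε₁ : ℝ) : ℂ)⁻¹ * gradInner (Ω₁set C) u v + (εσc C ω σ)⁻¹ * gradInner (Ω₂set C) u v -
  ((C.ε₁ : ℝ) : ℂ)⁻¹ *
    ∫ x in (0 : ℝ)..C.Λ, DtN C ω (traceΓ₀ C u) x * (starRingEnd ℂ) (v (x, C.h₁))

/-- A bounded linear extension operator `ℛ : H^{1/2}_{qp}(S) → H¹_{qp}(Ω₂)`
with `ℛ(ψ)|_S = ψ`. -/
structure ExtOp (C : Ctx) (ω : ℝ) where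
  map : (ℝ → ℂ) → Pt → ℂ
  map_add : ∀ ψ φ, map (ψ + φ) = map ψ + map φ
  map_smul : ∀ (c : ℂ) ψ, map (c • ψ) = c • map ψ
  map_trace : ∀ ψ, ∀ x ∈ Set.Ioo (0 : ℝ) C.Λ, map ψ (x, C.f x) = ψ x
  bounded : ∃ Cb > 0, ∀ ψ, H1normOn (Ω₂set C) (map ψ) ≤ Cb * HsNorm C ω (1 / 2) ψ

open scoped Classical in
/-- The coercivity-restoring operator `𝕋` (`𝕋v = v` in `Ω₁`, `𝕋v = -v + 2ℛ(v|_S)` in `Ω₂`). -/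
def TT (C : Ctx) (ω : ℝ) (R : ExtOp C ω) (u : Pt → ℂ) : Pt → ℂ :=
  fun p => if p ∈ Ω₂set C then -u p + 2 * R.map (traceS C u) p else u p

/-- `K = ⟨∇ℛ(u|_S), ∇ℛ(u|_S)⟩_{Ω₂} / ⟨ε₁⁻¹∇u, ∇u⟩_{Ω₁}`. -/
def Kconst (C : Ctx) (ω : ℝ) (R : ExtOp C ω) (u : Pt → ℂ) : ℝ :=
  gradL2On (Ω₂set C) (R.map (traceS C u)) / (C.ε₁⁻¹ * gradL2On (Ω₁set C) u)

/-- The standing assumption `sup_{σ>0} ((|ε₂|+σ/ω)/(ε₂²+(σ/ω)²)) K < 1`,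
where `K` is computed from the solutions `u_σ` of (Pσ). -/
def SupCond (C : Ctx) (ω : ℝ) (R : ExtOp C ω) : Prop :=
  ∃ c : ℝ, c < 1 ∧ ∀ σ > 0, ∀ g : ℝ → ℂ, ∀ u : Pt → ℂ, IsSolution C ω σ g u →
    ((|C.ε₂| + σ / ω) / (C.ε₂ ^ 2 + (σ / ω) ^ 2)) * Kconst C ω R u ≤ c

/-- A discrete subset of the reals. -/
def IsDiscreteIn (G : Set ℝ) : Prop :=
  ∀ x ∈ G, ∃ ε > 0, ∀ y ∈ G, |y - x| < ε → y = x

/-- Euclidean disk in the plane. -/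
def ball2 (c : Pt) (r : ℝ) : Set Pt := {p | (p.1 - c.1) ^ 2 + (p.2 - c.2) ^ 2 < r ^ 2}

/-- The union `N_r ∪ N_{-r}` of half-disks of radius `r` centered at points of `S`. -/
def Nset (C : Ctx) {m : ℕ} (cpts : Fin m → Pt) (r : ℝ) : Set Pt :=
  (⋃ i, ball2 (cpts i) r) ∩ (Ω₁set C ∪ Ω₂set C)

/- ### The transformed system (z4) on `D₊` -/

/-- The half-square `D₊ = (-1,1) × (0,1)`. -/
def Dplus : Set Pt := Set.Ioo (-1 : ℝ) 1 ×ˢ Set.Ioo (0 : ℝ) 1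

/-- The half-disk `B₊(0,r)`. -/
def Bplus (r : ℝ) : Set Pt := {p | 0 < p.2 ∧ p.1 ^ 2 + p.2 ^ 2 < r ^ 2}

/-- Original abscissa `x₁ = Λ(x̃₁+1)/2` of a transformed point. -/
def x1of (C : Ctx) (s : ℝ) : ℝ := C.Λ * (s + 1) / 2

/-- `f'` at the original abscissa. -/
def aof (C : Ctx) (s : ℝ) : ℝ := deriv C.f (x1of C s)

/-- `h₁ - f` at the original abscissa. -/
def hof (C : Ctx) (s : ℝ) : ℝ := C.h₁ - C.f (x1of C s)

/-- `f` at the original abscissa. -/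
def Fof (C : Ctx) (s : ℝ) : ℝ := C.f (x1of C s)

/-- Entry `(1,1)` of `Ψ*₊`. -/
def P11 (C : Ctx) (_p : Pt) : ℝ := 4 / C.Λ ^ 2

/-- Entry `(1,2) = (2,1)` of `Ψ*₊`. -/
def P12 (C : Ctx) (p : Pt) : ℝ := (2 / C.Λ) * aof C p.1 * (p.2 - 1) / hof C p.1

/-- Entry `(2,2)` of `Ψ*₊`. -/
def P22 (C : Ctx) (p : Pt) : ℝ := (aof C p.1 ^ 2 * (p.2 - 1) ^ 2 + 1) / hof C p.1 ^ 2

/-- Entry `(1,1)` of `Ψ̂*₊`. -/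
def Q11 (C : Ctx) (_p : Pt) : ℝ := 4 / C.Λ ^ 2

/-- Entry `(1,2) = (2,1)` of `Ψ̂*₊`. -/
def Q12 (C : Ctx) (p : Pt) : ℝ := (2 / C.Λ) * aof C p.1 * (1 - p.2) / Fof C p.1

/-- Entry `(2,2)` of `Ψ̂*₊`. -/
def Q22 (C : Ctx) (p : Pt) : ℝ := (aof C p.1 ^ 2 * (1 - p.2) ^ 2 + 1) / Fof C p.1 ^ 2

/-- The Jacobian factor `J₊ = (Λ/2)(h₁ - f)`. -/
def Jp (C : Ctx) (p : Pt) : ℝ := C.Λ / 2 * hof C p.1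

/-- The Jacobian factor `J₋ = (Λ/2) f`. -/
def Jm (C : Ctx) (p : Pt) : ℝ := C.Λ / 2 * Fof C p.1

/-- Pointwise divergence-form operator `∇·(A∇u)` for a symmetric matrix field `A`. -/
def divA (A11 A12 A22 : Pt → ℝ) (u : Pt → ℂ) (p : Pt) : ℂ :=
  fderiv ℝ (fun q => ((A11 q : ℝ) : ℂ) * fderiv ℝ u q (1, 0) +
      ((A12 q : ℝ) : ℂ) * fderiv ℝ u q (0, 1)) p (1, 0) +
  fderiv ℝ (fun q => ((A12 q : ℝ) : ℂ) * fderiv ℝ u q (1, 0) +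
      ((A22 q : ℝ) : ℂ) * fderiv ℝ u q (0, 1)) p (0, 1)

/-- `(u, w)` solves the transformed system (z4) on `D₊`, including the boundary
conditions `u = (ε₂ + iσ/ω) w` and
`ε₁⁻¹ J₊ (Ψ*₊∇u)ᵀ·n = -J₋ (Ψ̂*₊∇w)ᵀ·n` on `∂D₊ ∩ {x₂ = 0}`. -/
def IsZ4Solution (C : Ctx) (ω σ : ℝ) (u w : Pt → ℂ) : Prop :=
  (∀ p ∈ Dplus,
      (divA (Q11 C) (Q12 C) (Q22 C) w p +
        εσc C ω σ * (((ω ^ 2 * C.μ₂ : ℝ) : ℂ) + Complex.I * (σ : ℂ)) * w p) * ((Jm C p : ℝ) : ℂ)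
        = 0) ∧
  (∀ p ∈ Dplus,
      (divA (fun q => C.ε₁⁻¹ * P11 C q) (fun q => C.ε₁⁻¹ * P12 C q)
          (fun q => C.ε₁⁻¹ * P22 C q) u p + ((ω ^ 2 * C.μ₁ : ℝ) : ℂ) * u p) * ((Jp C p : ℝ) : ℂ)
        = 0) ∧
  (∀ s ∈ Set.Ioo (-1 : ℝ) 1, u (s, 0) = εσc C ω σ * w (s, 0)) ∧
  (∀ s ∈ Set.Ioo (-1 : ℝ) 1,
      ((C.ε₁⁻¹ * Jp C (s, 0) : ℝ) : ℂ) *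
          (((P12 C (s, 0) : ℝ) : ℂ) * fderiv ℝ u (s, 0) (1, 0) +
           ((P22 C (s, 0) : ℝ) : ℂ) * fderiv ℝ u (s, 0) (0, 1)) =
        -(((Jm C (s, 0) : ℝ) : ℂ) *
          (((Q12 C (s, 0) : ℝ) : ℂ) * fderiv ℝ w (s, 0) (1, 0) +
           ((Q22 C (s, 0) : ℝ) : ℂ) * fderiv ℝ w (s, 0) (0, 1))))

/- ### Principal symbols and the complementing boundary condition -/

/-- Principal symbol `L'₁₁(ξ₁, τ) = ε₁⁻¹ J₊ (Ψ*₊)ᵢⱼ ξᵢ ξⱼ` at a boundary point,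
as a polynomial in `τ`;  `a = f'`, `h = h₁ - f`. -/
def L1p (εi Λ a h ξ : ℝ) : Polynomial ℂ :=
  Polynomial.C (((εi⁻¹ * (2 * h / Λ) * ξ ^ 2 : ℝ) : ℂ)) +
  Polynomial.C (((εi⁻¹ * (-2 * a) * ξ : ℝ) : ℂ)) * Polynomial.X +
  Polynomial.C (((εi⁻¹ * (Λ * (a ^ 2 + 1) / (2 * h)) : ℝ) : ℂ)) * Polynomial.X ^ 2

/-- Principal symbol `L'₂₂(ξ₁, τ) = J₋ (Ψ̂*₊)ᵢⱼ ξᵢ ξⱼ` at a boundary point,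
as a polynomial in `τ`; `F = f`. -/
def L2p (Λ a F ξ : ℝ) : Polynomial ℂ :=
  Polynomial.C (((2 * F / Λ * ξ ^ 2 : ℝ) : ℂ)) +
  Polynomial.C (((2 * a * ξ : ℝ) : ℂ)) * Polynomial.X +
  Polynomial.C (((Λ * (a ^ 2 + 1) / (2 * F) : ℝ) : ℂ)) * Polynomial.X ^ 2

/-- Principal boundary symbol `B'₂₁ = ε₁⁻¹ J₊ ((Ψ*₊)₂₁ ξ₁ + (Ψ*₊)₂₂ τ)`. -/
def B21p (εi Λ a h ξ : ℝ) : Polynomial ℂ :=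
  Polynomial.C (((εi⁻¹ * (-a) * ξ : ℝ) : ℂ)) +
  Polynomial.C (((εi⁻¹ * (Λ * (a ^ 2 + 1) / (2 * h)) : ℝ) : ℂ)) * Polynomial.X

/-- Principal boundary symbol `B'₂₂ = J₋ ((Ψ̂*₊)₂₁ ξ₁ + (Ψ̂*₊)₂₂ τ)`. -/
def B22p (Λ a F ξ : ℝ) : Polynomial ℂ :=
  Polynomial.C (((a * ξ : ℝ) : ℂ)) +
  Polynomial.C (((Λ * (a ^ 2 + 1) / (2 * F) : ℝ) : ℂ)) * Polynomial.X

/-- `M⁺(τ) = (τ - τ₁⁺)(τ - τ₂⁺)`. -/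
def Mpoly (τ₁ τ₂ : ℂ) : Polynomial ℂ :=
  (Polynomial.X - Polynomial.C τ₁) * (Polynomial.X - Polynomial.C τ₂)

/-- Entry `(1,1)` of `(B'ᵢⱼ)(L*ⱼₖ)`: `1 · L'₂₂`. -/
def D11p (C : Ctx) (x ξ : ℝ) : Polynomial ℂ := L2p C.Λ (deriv C.f x) (C.f x) ξ

/-- Entry `(1,2)` of `(B'ᵢⱼ)(L*ⱼₖ)`: `-(ε₂ + iσ/ω) · L'₁₁`. -/
def D12p (C : Ctx) (ω σ x ξ : ℝ) : Polynomial ℂ :=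
  Polynomial.C (-(εσc C ω σ)) * L1p C.ε₁ C.Λ (deriv C.f x) (C.h₁ - C.f x) ξ

/-- Entry `(2,1)` of `(B'ᵢⱼ)(L*ⱼₖ)`: `B'₂₁ · L'₂₂`. -/
def D21p (C : Ctx) (x ξ : ℝ) : Polynomial ℂ :=
  B21p C.ε₁ C.Λ (deriv C.f x) (C.h₁ - C.f x) ξ * L2p C.Λ (deriv C.f x) (C.f x) ξ

/-- Entry `(2,2)` of `(B'ᵢⱼ)(L*ⱼₖ)`: `B'₂₂ · L'₁₁`. -/
def D22p (C : Ctx) (x ξ : ℝ) : Polynomial ℂ :=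
  B22p C.Λ (deriv C.f x) (C.f x) ξ * L1p C.ε₁ C.Λ (deriv C.f x) (C.h₁ - C.f x) ξ


theorem quad_factor (c b d : ℝ) (τ : ℂ) (him : 0 < τ.im)
    (h : (Polynomial.C (c : ℂ) + Polynomial.C (b : ℂ) * Polynomial.X
      + Polynomial.C (d : ℂ) * Polynomial.X ^ 2).IsRoot τ) :
    b = -2 * d * τ.re ∧ c = d * (τ.re ^ 2 + τ.im ^ 2) ∧
    (Polynomial.C (c : ℂ) + Polynomial.C (b : ℂ) * Polynomial.X
      + Polynomial.C (d : ℂ) * Polynomial.X ^ 2) =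
      (Polynomial.X - Polynomial.C τ) *
        (Polynomial.C (d : ℂ) * (Polynomial.X - Polynomial.C ((starRingEnd ℂ) τ))) := by
  have h' : (c : ℂ) + b * τ + d * τ ^ 2 = 0 := by
    simpa [Polynomial.IsRoot] using h
  have hr := congrArg Complex.re h'
  have hi := congrArg Complex.im h'
  simp [pow_two] at hr hi
  have hb : b = -2 * d * τ.re := by
    have : τ.im * (b + 2 * d * τ.re) = 0 := by linarith
    rcases mul_eq_zero.1 this with h0 | h0
    · exact absurd h0 him.ne'
    · linarith
  have hc : c = d * (τ.re ^ 2 + τ.im ^ 2) := by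
    rw [hb] at hr
    linarith
  refine ⟨hb, hc, ?_⟩
  have hbc : (b : ℂ) = -(d * (τ + (starRingEnd ℂ) τ)) := by
    apply Complex.ext <;> simp [hb]; ring
  have hcc : (c : ℂ) = d * (τ * (starRingEnd ℂ) τ) := by
    rw [Complex.mul_conj, Complex.normSq_apply, hc]
    push_cast
    ring
  rw [hbc, hcc]
  simp only [map_mul, map_add, map_neg]
  ring

/-- Cancel the root `τ` and evaluate the remaining factor at the other root `s`. -/
theorem eval_of_dvd (s τ : ℂ) (d : ℝ) (hd : d ≠ 0) (hs : 0 < s.im) (ht : 0 < τ.im)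
    (p : Polynomial ℂ)
    (h : (Polynomial.X - Polynomial.C s) * (Polynomial.X - Polynomial.C τ) ∣
      p * ((Polynomial.X - Polynomial.C τ) *
        (Polynomial.C (d : ℂ) * (Polynomial.X - Polynomial.C ((starRingEnd ℂ) τ))))) :
    p.eval s = 0 := by
  have h2 : (Polynomial.X - Polynomial.C s) ∣
      p * (Polynomial.C (d : ℂ) * (Polynomial.X - Polynomial.C ((starRingEnd ℂ) τ))) := by
    apply (mul_dvd_mul_iff_right (Polynomial.X_sub_C_ne_zero τ)).1
    convert h using 1
    ring
  have h3 := Polynomial.dvd_iff_isRoot.1 h2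
  simp only [Polynomial.IsRoot, Polynomial.eval_mul, Polynomial.eval_C, Polynomial.eval_sub,
    Polynomial.eval_X, mul_eq_zero] at h3
  rcases h3 with h3 | h3 | h3
  · exact h3
  · exact absurd (by exact_mod_cast h3) hd
  · have := congrArg Complex.im h3
    simp at this
    linarith

/-- The boundary conditions of the transformed system (z4) on
`∂D₊ ∩ {x₂ = 0}` are complementing boundary conditions in the sense of
Agmon–Douglis–Nirenberg: for every boundary point and every nonzero real tangent
frequency `ξ`, the rows of `(B'ᵢⱼ)(L*ⱼₖ)` are linearly independent modulo
`M⁺ = (τ - τ₁⁺)(τ - τ₂⁺)`, where `τ₁⁺, τ₂⁺` are the roots with positive imaginary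
part of the two factors of the principal symbol determinant. -/
theorem statement2 (C : Ctx) (ω σ : ℝ) (hω : 0 < ω) (hσ : 0 < σ)
    (x : ℝ) (hx : x ∈ Set.Ioo (0 : ℝ) C.Λ) (ξ : ℝ) (hξ : ξ ≠ 0) (τ₁ τ₂ : ℂ)
    (hτ₁ : (L1p C.ε₁ C.Λ (deriv C.f x) (C.h₁ - C.f x) ξ).IsRoot τ₁) (him₁ : 0 < τ₁.im)
    (hτ₂ : (L2p C.Λ (deriv C.f x) (C.f x) ξ).IsRoot τ₂) (him₂ : 0 < τ₂.im) :
    ∀ c₁ c₂ : ℂ,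
      (Mpoly τ₁ τ₂ ∣ Polynomial.C c₁ * D11p C x ξ + Polynomial.C c₂ * D21p C x ξ) →
      (Mpoly τ₁ τ₂ ∣ Polynomial.C c₁ * D12p C ω σ x ξ + Polynomial.C c₂ * D22p C x ξ) →
      c₁ = 0 ∧ c₂ = 0 := by
  intro c₁ c₂ h1 h2
  have hΛ := C.hΛ
  have hF := C.hfpos x
  have hh : 0 < C.h₁ - C.f x := sub_pos.2 (C.hfh x)
  have hε := C.hε₁
  unfold D12p D22p D11p D21p Mpoly at *
  unfold L1p at hτ₁ h2
  unfold L2p at hτ₂ h1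
  obtain ⟨hb1, hc1, hL1⟩ := quad_factor _ _ _ _ him₁ hτ₁
  obtain ⟨hb2, hc2, hL2⟩ := quad_factor _ _ _ _ him₂ hτ₂
  rw [hL1] at h2
  rw [hL2] at h1
  generalize hF' : C.f x = F at *
  generalize hh' : C.h₁ - F = h at *
  generalize ha' : deriv C.f x = a at *
  have hd1 : 0 < C.ε₁⁻¹ * (C.Λ * (a ^ 2 + 1) / (2 * h)) := by positivity
  have hd2 : 0 < C.Λ * (a ^ 2 + 1) / (2 * F) := by positivity
  have e1 := eval_of_dvd τ₁ τ₂ _ hd2.ne' him₁ him₂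
    (Polynomial.C c₁ + Polynomial.C c₂ * B21p C.ε₁ C.Λ a h ξ) (by convert h1 using 1; ring)
  have e2 := eval_of_dvd τ₂ τ₁ _ hd1.ne' him₂ him₁
    (Polynomial.C c₁ * Polynomial.C (-(εσc C ω σ)) + Polynomial.C c₂ * B22p C.Λ a F ξ)
    (by convert h2 using 1 <;> ring)
  have q1 : C.ε₁⁻¹ * (2 * h / C.Λ * ξ ^ 2) * (C.Λ * (a ^ 2 + 1) / (2 * h)) =
      C.ε₁⁻¹ * ((a ^ 2 + 1) * ξ ^ 2) := by field_simp
  have q2 : (2 * F / C.Λ * ξ ^ 2) * (C.Λ * (a ^ 2 + 1) / (2 * F)) =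
      (a ^ 2 + 1) * ξ ^ 2 := by field_simp
  unfold B21p at e1
  unfold B22p at e2
  generalize C.Λ * (a ^ 2 + 1) / (2 * h) = d1 at *
  generalize C.Λ * (a ^ 2 + 1) / (2 * F) = d2 at *
  have hi : C.ε₁⁻¹ ≠ 0 := by positivity
  have hi0 : 0 < C.ε₁⁻¹ := by positivity
  have hd1' : 0 < d1 := (mul_pos_iff_of_pos_left hi0).1 hd1
  have hb1' : a * ξ = d1 * τ₁.re := by
    apply mul_left_cancel₀ hi
    linarith
  have hb2' : a * ξ = -(d2 * τ₂.re) := by linarith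
  have hc1' : 2 * h / C.Λ * ξ ^ 2 = d1 * (τ₁.re ^ 2 + τ₁.im ^ 2) := by
    apply mul_left_cancel₀ hi
    linarith
  have k1 : (d1 * τ₁.im) ^ 2 = ξ ^ 2 := by
    have q1' : (2 * h / C.Λ * ξ ^ 2) * d1 = (a ^ 2 + 1) * ξ ^ 2 := by
      apply mul_left_cancel₀ hi
      linarith
    rw [hc1'] at q1'
    linear_combination q1' + (a * ξ + d1 * τ₁.re) * hb1'
  have k2 : (d2 * τ₂.im) ^ 2 = ξ ^ 2 := by
    rw [hc2] at q2
    linear_combination q2 + (a * ξ - d2 * τ₂.re) * hb2'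
  have hk : d1 * τ₁.im = d2 * τ₂.im := by
    have p1 : 0 < d1 * τ₁.im := by positivity
    have p2 : 0 < d2 * τ₂.im := by positivity
    nlinarith
  have v1 : (d1 : ℂ) * τ₁ - (a : ℂ) * ξ = Complex.I * ((d1 * τ₁.im : ℝ) : ℂ) := by
    apply Complex.ext <;> simp
    linarith
  have v2 : (d2 : ℂ) * τ₂ + (a : ℂ) * ξ = Complex.I * ((d1 * τ₁.im : ℝ) : ℂ) := by
    rw [hk]
    apply Complex.ext <;> simp
    linarith
  have hkpos : d1 * τ₁.im ≠ 0 := by positivity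
  generalize d1 * τ₁.im = k at *
  simp at e1 e2
  have hεc : (C.ε₁ : ℂ) ≠ 0 := by exact_mod_cast hε.ne'
  have E1 : c₁ * C.ε₁ + c₂ * (Complex.I * k) = 0 := by
    rw [← v1]
    have := congrArg (fun z => (C.ε₁ : ℂ) * z) e1
    field_simp at this
    linear_combination this
  have E2 : -(c₁ * εσc C ω σ) + c₂ * (Complex.I * k) = 0 := by
    rw [← v2]
    linear_combination e2
  have hne : (C.ε₁ : ℂ) + εσc C ω σ ≠ 0 := by
    intro h0
    have := congrArg Complex.im h0
    simp [εσc, Complex.div_ofReal_im] at this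
    rcases this with h | h
    · exact hσ.ne' h
    · exact hω.ne' h
  have z1 : c₁ = 0 := by
    have : c₁ * ((C.ε₁ : ℂ) + εσc C ω σ) = 0 := by linear_combination E1 - E2
    exact (mul_eq_zero.1 this).resolve_right hne
  refine ⟨z1, ?_⟩
  rw [z1] at E1
  have hkc : (k : ℂ) ≠ 0 := by exact_mod_cast hkpos
  simpa [hkc] using E1

end Helmholtz
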